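/- For every bounded continuous f : ℝ^N → ℝ there exists a unique BC-solution of the nonlocal Stefan problem with initial datum f, i.e. a unique function u : ℝ^N × [0,∞) → ℝ, continuous and bounded on ℝ^N × [0,T] for every T > 0, such that u(x,t) = f(x) + ∫₀ᵗ ((J∗v)(x,s) − v(x,s)) ds for all x ∈ ℝ^N and t ≥ 0, where v = (u − 1)₊ and the convolution is taken in the space variable. -/

import Mathlib

open MeasureTheory Filter
open scoped Topology Pointwise

noncomputable section

abbrev Spc (N : ℕ) := EuclideanSpace ℝ (Fin N)

variable {N : ℕ}

/-- Convolution in the space variable: `(J ∗ v)(x) = ∫ J(x−y) v(y) dy`. -/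
def convol (J v : Spc N → ℝ) : Spc N → ℝ := fun x => ∫ y, J (x - y) * v y

/-- The temperature associated to an enthalpy `g`: `(g − 1)₊`. -/
def tempr (g : Spc N → ℝ) : Spc N → ℝ := fun x => max (g x - 1) 0

/-- Hypotheses on the kernel `J`: continuous, nonnegative, radially symmetric,
supported in the closed ball of radius `RJ > 0`, with unit mass. -/
structure IsKernel (J : Spc N → ℝ) (RJ : ℝ) : Prop where
  cont : Continuous J
  nonneg : ∀ x, 0 ≤ J x
  radial : ∀ x y : Spc N, ‖x‖ = ‖y‖ → J x = J y
  supp_subset : ∀ x : Spc N, RJ < ‖x‖ → J x = 0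
  radius_pos : 0 < RJ
  mass : ∫ x, J x = 1

/-- `u` is an L¹-solution of the nonlocal Stefan problem with initial datum `f`:
a continuous curve in L¹ such that `u(t) = f + ∫₀ᵗ (J∗v(s) − v(s)) ds` with `v = (u−1)₊`. -/
structure IsL1Solution (J f : Spc N → ℝ) (u : ℝ → Spc N → ℝ) : Prop where
  integrable : ∀ t, 0 ≤ t → Integrable (u t)
  contL1 : ∀ t, 0 ≤ t →
    Tendsto (fun s => ∫ x, |u s x - u t x|) (𝓝[Set.Ici (0:ℝ)] t) (𝓝 0)
  eqn : ∀ t, 0 ≤ t → ∀ᵐ x ∂(volume : Measure (Spc N)), u t x =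
    f x + ∫ s in (0:ℝ)..t, (convol J (tempr (u s)) x - tempr (u s) x)

/-- `u` is a BC-solution of the nonlocal Stefan problem with (bounded continuous) initial
datum `f`: continuous and bounded on `ℝ^N × [0,T]` for every `T > 0`, and satisfying the
integral equation pointwise, with `v = (u − 1)₊`, the convolution in the space variable. -/
structure IsBCSolution (J f : Spc N → ℝ) (u : Spc N → ℝ → ℝ) : Prop where
  cont : ContinuousOn (fun p : Spc N × ℝ => u p.1 p.2) {p : Spc N × ℝ | 0 ≤ p.2}
  bdd : ∀ T, 0 < T → ∃ C, ∀ x : Spc N, ∀ t ∈ Set.Icc (0:ℝ) T, |u x t| ≤ C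
  eqn : ∀ x : Spc N, ∀ t, 0 ≤ t → u x t =
    f x + ∫ s in (0:ℝ)..t,
      ((∫ y, J (x - y) * max (u y s - 1) 0) - max (u x s - 1) 0)

/-- The right-hand side of the equation. -/
def stefK (J : Spc N → ℝ) (u : Spc N → ℝ → ℝ) (x : Spc N) (s : ℝ) : ℝ :=
  (∫ y, J (x - y) * max (u y s - 1) 0) - max (u x s - 1) 0

lemma stefK_cont {J : Spc N → ℝ} {RJ : ℝ} (hJ : IsKernel J RJ) {u : Spc N → ℝ → ℝ}
    (hu : Continuous (fun p : Spc N × ℝ => u p.1 p.2)) :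
    Continuous (fun p : Spc N × ℝ => stefK J u p.1 p.2) := by
  have h1 : ∀ p : Spc N × ℝ, (∫ y, J (p.1 - y) * max (u y p.2 - 1) 0)
      = ∫ z in Metric.closedBall (0 : Spc N) RJ, J z * max (u (p.1 - z) p.2 - 1) 0 := by
    intro p
    rw [← integral_sub_left_eq_self (fun y => J (p.1 - y) * max (u y p.2 - 1) 0) volume p.1]
    simp only [sub_sub_cancel]
    symm
    apply setIntegral_eq_integral_of_forall_compl_eq_zero
    intro z hz
    rw [hJ.supp_subset z (by simpa using hz), zero_mul]
  have hc := hJ.cont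
  unfold stefK
  simp_rw [h1]
  refine Continuous.sub ?_ (by fun_prop)
  refine continuous_parametric_integral_of_continuous (f := fun (p : Spc N × ℝ) (z : Spc N) =>
    J z * max (u (p.1 - z) p.2 - 1) 0) ?_ (isCompact_closedBall _ _)
  have h2 : Continuous (fun q : (Spc N × ℝ) × Spc N => u (q.1.1 - q.2) q.1.2) :=
    hu.comp (f := fun q : (Spc N × ℝ) × Spc N => (q.1.1 - q.2, q.1.2)) (by fun_prop)
  unfold Function.uncurry
  fun_prop

lemma kern_hcs {J : Spc N → ℝ} {RJ : ℝ} (hJ : IsKernel J RJ) (x : Spc N) :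
    HasCompactSupport (fun y => J (x - y)) := by
  refine HasCompactSupport.intro (isCompact_closedBall x RJ) ?_
  intro y hy
  apply hJ.supp_subset
  rw [Metric.mem_closedBall, not_le, dist_comm, dist_eq_norm] at hy
  exact hy

lemma posp_lip (a b : ℝ) : |max (a - 1) 0 - max (b - 1) 0| ≤ |a - b| := by
  have := abs_max_sub_max_le_abs (a - 1) (b - 1) 0
  simpa using this

lemma stefK_lip {J : Spc N → ℝ} {RJ : ℝ} (hJ : IsKernel J RJ) {u₁ u₂ : Spc N → ℝ → ℝ} (s M : ℝ)
    (h1 : Continuous (fun y => u₁ y s)) (h2 : Continuous (fun y => u₂ y s))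
    (hM : ∀ y, |u₁ y s - u₂ y s| ≤ M) (x : Spc N) :
    |stefK J u₁ x s - stefK J u₂ x s| ≤ 2 * M := by
  have hc := hJ.cont
  have hJc : Continuous (fun y => J (x - y)) := by fun_prop
  have i1 : Integrable (fun y => J (x - y) * max (u₁ y s - 1) 0) :=
    Continuous.integrable_of_hasCompactSupport (by fun_prop) (kern_hcs hJ x).mul_right
  have i2 : Integrable (fun y => J (x - y) * max (u₂ y s - 1) 0) :=
    Continuous.integrable_of_hasCompactSupport (by fun_prop) (kern_hcs hJ x).mul_right
  have i3 : Integrable (fun y => J (x - y)) :=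
    hJc.integrable_of_hasCompactSupport (kern_hcs hJ x)
  have key : |(∫ y, J (x - y) * max (u₁ y s - 1) 0) - ∫ y, J (x - y) * max (u₂ y s - 1) 0| ≤ M := by
    rw [← integral_sub i1 i2]
    calc _ ≤ ∫ y, J (x - y) * M := by
          rw [← Real.norm_eq_abs]
          refine norm_integral_le_of_norm_le (i3.mul_const M) (Eventually.of_forall fun y => ?_)
          rw [← mul_sub, Real.norm_eq_abs, abs_mul, abs_of_nonneg (hJ.nonneg _)]
          exact mul_le_mul_of_nonneg_left ((posp_lip _ _).trans (hM y)) (hJ.nonneg _)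
      _ = M := by
          rw [integral_mul_const, integral_sub_left_eq_self J volume x, hJ.mass, one_mul]
  have k2 := (posp_lip (u₁ x s) (u₂ x s)).trans (hM x)
  unfold stefK
  rw [abs_le] at *
  constructor <;> linarith [key.1, key.2, k2.1, k2.2]

lemma stefK_int {J : Spc N → ℝ} {RJ : ℝ} (hJ : IsKernel J RJ) {u₁ u₂ : Spc N → ℝ → ℝ}
    (h1 : Continuous (fun p : Spc N × ℝ => u₁ p.1 p.2))
    (h2 : Continuous (fun p : Spc N × ℝ => u₂ p.1 p.2)) (t M : ℝ) (ht : 0 ≤ t) (hM0 : 0 ≤ M)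
    (hM : ∀ y, ∀ s ∈ Set.Icc 0 t, |u₁ y s - u₂ y s| ≤ M * Real.exp (3 * s)) (x : Spc N) :
    |(∫ s in (0:ℝ)..t, stefK J u₁ x s) - ∫ s in (0:ℝ)..t, stefK J u₂ x s|
      ≤ 2 / 3 * M * Real.exp (3 * t) := by
  have c1 : Continuous (fun s => stefK J u₁ x s) :=
    (stefK_cont hJ h1).comp (f := fun s => (x, s)) (by fun_prop)
  have c2 : Continuous (fun s => stefK J u₂ x s) :=
    (stefK_cont hJ h2).comp (f := fun s => (x, s)) (by fun_prop)
  rw [← intervalIntegral.integral_sub (c1.intervalIntegrable _ _) (c2.intervalIntegrable _ _)]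
  have hb : Continuous (fun s : ℝ => 2 * (M * Real.exp (3 * s))) := by fun_prop
  calc _ ≤ ∫ s in (0:ℝ)..t, 2 * (M * Real.exp (3 * s)) := by
        rw [← Real.norm_eq_abs]
        refine intervalIntegral.norm_integral_le_of_norm_le ht
          (Eventually.of_forall fun s hs => ?_) (hb.intervalIntegrable _ _)
        exact stefK_lip hJ s _ (h1.comp (f := fun y => (y, s)) (by fun_prop))
          (h2.comp (f := fun y => (y, s)) (by fun_prop)) (fun y => hM y s ⟨hs.1.le, hs.2⟩) x
    _ = 2 / 3 * M * (Real.exp (3 * t) - 1) := by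
        rw [intervalIntegral.integral_eq_sub_of_hasDerivAt
          (f := fun s => 2 / 3 * M * Real.exp (3 * s)) _ (hb.intervalIntegrable _ _)]
        · simp; ring
        · intro s _
          have := (((hasDerivAt_id s).const_mul 3).exp).const_mul (2 / 3 * M)
          refine this.congr_deriv ?_
          simp; ring
    _ ≤ _ := by nlinarith

lemma stefK_zero (J : Spc N → ℝ) (x : Spc N) (s : ℝ) : stefK J (fun _ _ => 0) x s = 0 := by
  simp [stefK]

/-- Weighted unknown to original unknown. -/
def wt (w : Spc N × ℝ → ℝ) : Spc N → ℝ → ℝ := fun y s => Real.exp (3 * max s 0) * w (y, s)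

/-- Picard map, in weighted form. -/
def picF (J f : Spc N → ℝ) (w : Spc N × ℝ → ℝ) (p : Spc N × ℝ) : ℝ :=
  Real.exp (-(3 * max p.2 0)) * (f p.1 + ∫ s in (0:ℝ)..(max p.2 0), stefK J (wt w) p.1 s)

lemma wt_cont (w : Spc N × ℝ → ℝ) (hw : Continuous w) :
    Continuous (fun p : Spc N × ℝ => wt w p.1 p.2) := by
  unfold wt; fun_prop

lemma picF_cont {J : Spc N → ℝ} {RJ : ℝ} (hJ : IsKernel J RJ) {f : Spc N → ℝ} (hf : Continuous f)
    (w : Spc N × ℝ → ℝ) (hw : Continuous w) : Continuous (picF J f w) := by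
  have hk := stefK_cont hJ (wt_cont w hw)
  have : Continuous (fun p : Spc N × ℝ => ∫ s in (0:ℝ)..(max p.2 0), stefK J (wt w) p.1 s) := by
    apply intervalIntegral.continuous_parametric_intervalIntegral_of_continuous
      (f := fun (p : Spc N × ℝ) s => stefK J (wt w) p.1 s)
    · exact hk.comp (f := fun q : (Spc N × ℝ) × ℝ => (q.1.1, q.2)) (by fun_prop)
    · fun_prop
  unfold picF
  fun_prop

lemma exp_cancel (a b c : ℝ) (h : |a| ≤ c * Real.exp b) : |Real.exp (-b) * a| ≤ c := by
  rw [abs_mul, abs_of_pos (Real.exp_pos _), Real.exp_neg, inv_mul_le_iff₀ (Real.exp_pos _),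
    mul_comm]
  exact h

lemma picF_lip {J : Spc N → ℝ} {RJ : ℝ} (hJ : IsKernel J RJ) {f : Spc N → ℝ}
    (w₁ w₂ : Spc N × ℝ → ℝ) (h₁ : Continuous w₁) (h₂ : Continuous w₂) (M : ℝ) (hM0 : 0 ≤ M)
    (hM : ∀ p, |w₁ p - w₂ p| ≤ M) (p : Spc N × ℝ) :
    |picF J f w₁ p - picF J f w₂ p| ≤ 2 / 3 * M := by
  unfold picF
  rw [← mul_sub, add_sub_add_left_eq_sub]
  apply exp_cancel
  refine stefK_int hJ (wt_cont w₁ h₁) (wt_cont w₂ h₂) _ M (le_max_right _ _) hM0 ?_ _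
  intro y s hs
  unfold wt
  rw [← mul_sub, abs_mul, abs_of_pos (Real.exp_pos _), max_eq_left hs.1, mul_comm]
  exact mul_le_mul_of_nonneg_right (hM _) (Real.exp_pos _).le

lemma picF_bdd {J : Spc N → ℝ} {RJ : ℝ} (hJ : IsKernel J RJ) {f : Spc N → ℝ} {C : ℝ}
    (hC : ∀ x, |f x| ≤ C)
    (w : Spc N × ℝ → ℝ) (h : Continuous w) (M : ℝ) (hM0 : 0 ≤ M)
    (hM : ∀ p, |w p| ≤ M) (p : Spc N × ℝ) :
    |picF J f w p| ≤ C + 2 / 3 * M := by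
  have h1 := picF_lip (f := f) hJ w (fun _ => 0) h continuous_const M hM0 (by simpa using hM) p
  have h2 : |picF J f (fun _ => 0) p| ≤ C := by
    unfold picF
    apply exp_cancel
    have : wt (N := N) (fun _ => 0) = fun _ _ => 0 := by funext y s; simp [wt]
    rw [this]
    simp only [stefK_zero, intervalIntegral.integral_zero, add_zero]
    have h3 : 1 ≤ Real.exp (3 * max p.2 0) := Real.one_le_exp (by positivity)
    have h4 := hC p.1
    nlinarith [abs_nonneg (f p.1)]
  rw [abs_le] at *
  constructor <;> linarith [h1.1, h1.2, h2.1, h2.2]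

open BoundedContinuousFunction in
lemma exists_fix {J : Spc N → ℝ} {RJ : ℝ} (hJ : IsKernel J RJ) {f : Spc N → ℝ}
    (hf : Continuous f) {C : ℝ} (hC : ∀ x, |f x| ≤ C) :
    ∃ w : (Spc N × ℝ) →ᵇ ℝ, ∀ p, picF J f w p = w p := by
  let Φ : ((Spc N × ℝ) →ᵇ ℝ) → ((Spc N × ℝ) →ᵇ ℝ) := fun w =>
    BoundedContinuousFunction.ofNormedAddCommGroup (picF J f w) (picF_cont hJ hf w w.continuous)
      (C + 2 / 3 * ‖w‖) (fun p => picF_bdd hJ hC w w.continuous ‖w‖ (norm_nonneg _)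
        (fun q => w.norm_coe_le_norm q) p)
  have hΦ : ContractingWith (2 / 3 : NNReal) Φ := by
    refine ⟨?_, LipschitzWith.of_dist_le_mul fun w₁ w₂ => ?_⟩
    · rw [← NNReal.coe_lt_coe]; norm_num
    · rw [BoundedContinuousFunction.dist_le (by positivity)]
      intro p
      have := picF_lip (f := f) hJ w₁ w₂ w₁.continuous w₂.continuous (dist w₁ w₂) dist_nonneg
        (fun q => by rw [← Real.dist_eq]; exact BoundedContinuousFunction.dist_coe_le_dist q) p
      simpa [Real.dist_eq, Φ] using this
  refine ⟨ContractingWith.fixedPoint Φ hΦ, fun p => ?_⟩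
  have := hΦ.fixedPoint_isFixedPt
  exact congrArg (fun g : (Spc N × ℝ) →ᵇ ℝ => g p) this

lemma bc_exists {J : Spc N → ℝ} {RJ : ℝ} (hJ : IsKernel J RJ) {f : Spc N → ℝ}
    (hf : Continuous f) {C : ℝ} (hC : ∀ x, |f x| ≤ C) :
    ∃ u : Spc N → ℝ → ℝ, IsBCSolution J f u := by
  obtain ⟨w, hw⟩ := exists_fix hJ hf hC
  refine ⟨wt w, (wt_cont w w.continuous).continuousOn, ?_, ?_⟩
  · intro T _
    refine ⟨Real.exp (3 * T) * ‖w‖, fun x t ht => ?_⟩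
    unfold wt
    rw [abs_mul, abs_of_pos (Real.exp_pos _), max_eq_left ht.1]
    refine mul_le_mul (Real.exp_le_exp.2 (by linarith [ht.2])) (w.norm_coe_le_norm _)
      (abs_nonneg _) (Real.exp_pos _).le
  · intro x t ht
    have h := hw (x, t)
    change wt w x t = f x + ∫ s in (0:ℝ)..t, stefK J (wt w) x s
    unfold picF at h
    simp only [max_eq_left ht] at h
    conv_lhs => unfold wt
    rw [← h, max_eq_left ht, ← mul_assoc, ← Real.exp_add]
    simp

lemma bc_unique {J : Spc N → ℝ} {RJ : ℝ} (hJ : IsKernel J RJ) {f : Spc N → ℝ}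
    (u₁ u₂ : Spc N → ℝ → ℝ) (h₁ : IsBCSolution J f u₁) (h₂ : IsBCSolution J f u₂)
    (x : Spc N) (t : ℝ) (ht : 0 ≤ t) : u₁ x t = u₂ x t := by
  have ext_cont : ∀ u : Spc N → ℝ → ℝ, IsBCSolution J f u →
      Continuous (fun p : Spc N × ℝ => u p.1 (max p.2 0)) := by
    intro u hu
    exact hu.cont.comp_continuous (f := fun p : Spc N × ℝ => (p.1, max p.2 0)) (by fun_prop)
      (fun p => show (0:ℝ) ≤ max p.2 0 from le_max_right _ _)
  have ext_eq : ∀ u : Spc N → ℝ → ℝ, IsBCSolution J f u → ∀ x : Spc N, ∀ t, 0 ≤ t →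
      u x t = f x + ∫ s in (0:ℝ)..t, stefK J (fun y s => u y (max s 0)) x s := by
    intro u hu x t ht
    rw [hu.eqn x t ht]
    congr 1
    apply intervalIntegral.integral_congr
    intro s hs
    rw [Set.uIcc_of_le ht] at hs
    simp only [stefK, max_eq_left hs.1]
  obtain ⟨C₁, hC₁⟩ := h₁.bdd (t + 1) (by linarith)
  obtain ⟨C₂, hC₂⟩ := h₂.bdd (t + 1) (by linarith)
  have hC₁0 : 0 ≤ C₁ := (abs_nonneg _).trans (hC₁ x 0 ⟨le_rfl, by linarith⟩)
  have hC₂0 : 0 ≤ C₂ := (abs_nonneg _).trans (hC₂ x 0 ⟨le_rfl, by linarith⟩)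
  have key : ∀ n : ℕ, ∀ y, ∀ s ∈ Set.Icc 0 t,
      |u₁ y s - u₂ y s| ≤ (2 / 3) ^ n * (C₁ + C₂) * Real.exp (3 * s) := by
    intro n
    induction n with
    | zero =>
      intro y s hs
      have a := hC₁ y s ⟨hs.1, by linarith [hs.2]⟩
      have b := hC₂ y s ⟨hs.1, by linarith [hs.2]⟩
      have c : 1 ≤ Real.exp (3 * s) := Real.one_le_exp (by linarith [hs.1])
      have d := abs_sub (u₁ y s) (u₂ y s)
      rw [pow_zero, one_mul]
      nlinarith
    | succ n ih =>
      intro y s hs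
      rw [ext_eq u₁ h₁ y s hs.1, ext_eq u₂ h₂ y s hs.1, add_sub_add_left_eq_sub]
      refine (stefK_int hJ (ext_cont u₁ h₁) (ext_cont u₂ h₂) s ((2 / 3) ^ n * (C₁ + C₂)) hs.1
        (by positivity) ?_ y).trans (le_of_eq (by ring))
      intro z r hr
      simp only [max_eq_left hr.1]
      exact ih z r ⟨hr.1, hr.2.trans hs.2⟩
  have lim : Tendsto (fun n : ℕ => (2 / 3 : ℝ) ^ n * (C₁ + C₂) * Real.exp (3 * t)) atTop (𝓝 0) := by
    have := ((tendsto_pow_atTop_nhds_zero_of_lt_one (r := (2 / 3 : ℝ)) (by norm_num)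
      (by norm_num)).mul_const (C₁ + C₂)).mul_const (Real.exp (3 * t))
    simpa using this
  have := ge_of_tendsto' lim (fun n => key n x t ⟨ht, le_rfl⟩)
  exact sub_eq_zero.1 (abs_nonpos_iff.1 this)

/-- For every bounded continuous `f : ℝ^N → ℝ` there exists a unique
BC-solution of the nonlocal Stefan problem with initial datum `f`. -/
theorem stefan_nonlocal_BC_existence_uniqueness
    (N : ℕ) (hN : 1 ≤ N) (J : Spc N → ℝ) (RJ : ℝ) (hJ : IsKernel J RJ)
    (f : Spc N → ℝ) (hfc : Continuous f) (hfb : ∃ C, ∀ x, |f x| ≤ C) :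
    (∃ u : Spc N → ℝ → ℝ, IsBCSolution J f u) ∧
    (∀ u₁ u₂ : Spc N → ℝ → ℝ, IsBCSolution J f u₁ → IsBCSolution J f u₂ →
      ∀ x : Spc N, ∀ t, 0 ≤ t → u₁ x t = u₂ x t) := by
  obtain ⟨C, hC⟩ := hfb
  exact ⟨bc_exists hJ hfc hC, fun u₁ u₂ h₁ h₂ x t ht => bc_unique hJ u₁ u₂ h₁ h₂ x t ht⟩
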